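/- arXiv:1106.3453 — 2 statements merged into one kernel-verified Lean document; each statement's English description precedes it below -/
import Mathlib

section
/- Let m ≥ 3 and n ≥ 2 be integers. Then the locating chromatic number of K_m □ P_n equals m + 2 if m ≤ n − 2, and equals m + 1 if m ≥ n − 1. -/
open SimpleGraph

/-- The distance from a vertex to a set of vertices. -/
noncomputable def setDist {V : Type*} (G : SimpleGraph V) (v : V) (S : Set V) : ℕ :=
  sInf (G.dist v '' S)

/-- The color code of a vertex with respect to a `k`-coloring `c`:
the tuple of distances to the color classes. -/
noncomputable def colorCode {V : Type*} (G : SimpleGraph V) {k : ℕ} (c : V → Fin k)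
    (v : V) : Fin k → ℕ :=
  fun i => setDist G v (c ⁻¹' {i})

/-- `c` is a locating `k`-coloring of `G`: a proper coloring onto the `k` colors
such that distinct vertices have distinct color codes. -/
def IsLocatingColoring {V : Type*} (G : SimpleGraph V) {k : ℕ} (c : V → Fin k) : Prop :=
  Function.Surjective c ∧
  (∀ u v : V, G.Adj u v → c u ≠ c v) ∧
  Function.Injective (colorCode G c)

/-- The locating chromatic number: the least `k` admitting a locating `k`-coloring. -/
noncomputable def locatingChromaticNumber {V : Type*} (G : SimpleGraph V) : ℕ :=
  sInf {k : ℕ | ∃ c : V → Fin k, IsLocatingColoring G c}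

/-- A vertex is colorful w.r.t. a coloring `c` if every color appears in its
closed neighborhood. -/
def IsColorful {V : Type*} (G : SimpleGraph V) {k : ℕ} (c : V → Fin k) (v : V) : Prop :=
  ∀ i : Fin k, ∃ u : V, (u = v ∨ G.Adj v u) ∧ c u = i

abbrev GG (m n : ℕ) : SimpleGraph (Fin m × Fin n) := (⊤ : SimpleGraph (Fin m)) □ pathGraph n

def DD {m n : ℕ} (x y : Fin m × Fin n) : ℕ :=
  (if x.1 = y.1 then 0 else 1) + ((x.2.val - y.2.val) + (y.2.val - x.2.val))

lemma pg_reach {n : ℕ} : ∀ (d : ℕ) (i j : Fin n), i.val + d = j.val →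
    ∃ p : (pathGraph n).Walk i j, p.length = d
  | 0, i, j, h => by
    have : i = j := Fin.ext (by omega)
    subst this
    exact ⟨Walk.nil, rfl⟩
  | d+1, i, j, h => by
    obtain ⟨p, hp⟩ := pg_reach d ⟨i.val + 1, by omega⟩ j (by simp; omega)
    exact ⟨Walk.cons (by rw [pathGraph_adj]; left; rfl) p, by simp [hp]⟩

lemma pg_lower {n : ℕ} {i j : Fin n} (p : (pathGraph n).Walk i j) :
    i.val ≤ j.val + p.length ∧ j.val ≤ i.val + p.length := by
  induction p with
  | nil => simp
  | cons h p ih =>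
    rw [pathGraph_adj] at h
    simp only [Walk.length_cons]
    omega

lemma pg_dist {n : ℕ} (i j : Fin n) :
    (pathGraph n).dist i j = (i.val - j.val) + (j.val - i.val) := by
  apply le_antisymm
  · rcases le_total i.val j.val with h | h
    · obtain ⟨p, hp⟩ := pg_reach (j.val - i.val) i j (by omega)
      have := dist_le p
      omega
    · obtain ⟨p, hp⟩ := pg_reach (i.val - j.val) j i (by omega)
      have := dist_le p
      rw [SimpleGraph.dist_comm] at this
      omega
  · obtain ⟨p, hp⟩ := ((pathGraph_preconnected n) i j).exists_walk_length_eq_dist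
    have := pg_lower p
    omega

lemma gg_dist {m n : ℕ} (x y : Fin m × Fin n) : (GG m n).dist x y = DD x y := by
  have h1 : (⊤ : SimpleGraph (Fin m)).edist x.1 y.1 ≠ ⊤ :=
    edist_ne_top_iff_reachable.2 (preconnected_top _ _)
  have h2 : (pathGraph n).edist x.2 y.2 ≠ ⊤ :=
    edist_ne_top_iff_reachable.2 (pathGraph_preconnected n _ _)
  unfold SimpleGraph.dist
  rw [edist_boxProd, ENat.toNat_add h1 h2]
  have e1 : ((⊤ : SimpleGraph (Fin m)).edist x.1 y.1).toNat = if x.1 = y.1 then 0 else 1 :=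
    dist_top
  have e2 := pg_dist x.2 y.2
  unfold SimpleGraph.dist at e2
  rw [e1, e2]
  rfl

lemma gg_adj {m n : ℕ} (x y : Fin m × Fin n) : (GG m n).Adj x y ↔ DD x y = 1 := by
  rw [← gg_dist, dist_eq_one_iff_adj]

lemma code_le {m n k : ℕ} (c : Fin m × Fin n → Fin k) (v y : Fin m × Fin n) :
    colorCode (GG m n) c v (c y) ≤ DD v y := by
  rw [← gg_dist]
  exact Nat.sInf_le ⟨y, rfl, rfl⟩

lemma code_ex {m n k : ℕ} (c : Fin m × Fin n → Fin k) (v y : Fin m × Fin n) :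
    ∃ z, c z = c y ∧ colorCode (GG m n) c v (c y) = DD v z := by
  have := Nat.sInf_mem (s := (GG m n).dist v '' (c ⁻¹' {c y})) ⟨_, y, rfl, rfl⟩
  obtain ⟨z, hz, hz2⟩ := this
  exact ⟨z, hz, by rw [← gg_dist, hz2]; rfl⟩

lemma code_eq {m n k : ℕ} (c : Fin m × Fin n → Fin k) (v y : Fin m × Fin n) (A : Fin k)
    (hA : c y = A) (h : ∀ z, c z = A → DD v y ≤ DD v z) :
    colorCode (GG m n) c v A = DD v y := by
  subst hA
  apply le_antisymm (code_le c v y)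
  obtain ⟨z, hz, e⟩ := code_ex c v y
  rw [e]; exact h z hz

lemma DD_zero {m n : ℕ} {x y : Fin m × Fin n} (h : DD x y = 0) : x = y := by
  unfold DD at h
  apply Prod.ext
  · by_contra h'; simp [h'] at h
  · apply Fin.ext; omega

lemma code_self {m n k : ℕ} (c : Fin m × Fin n → Fin k) (v : Fin m × Fin n) :
    colorCode (GG m n) c v (c v) = 0 := by
  have := code_le c v v
  simpa [DD] using this

lemma code_one {m n k : ℕ} (c : Fin m × Fin n → Fin k) (v y : Fin m × Fin n) (A : Fin k)
    (hv : c v ≠ A) (hy : c y = A) (h : DD v y = 1) :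
    colorCode (GG m n) c v A = 1 := by
  rw [← h]
  apply code_eq c v y A hy
  intro z hz
  rw [h]
  by_contra h'
  have := DD_zero (show DD v z = 0 by omega)
  subst this
  exact hv hz

lemma code_col {m n k : ℕ} (c : Fin m × Fin n → Fin k) (r s : Fin m) (j : Fin n) (A : Fin k)
    (hv : c (r, j) ≠ A) (hy : c (s, j) = A) :
    colorCode (GG m n) c (r, j) A = 1 := by
  apply code_one c _ (s, j) A hv hy
  have : r ≠ s := by rintro rfl; exact hv hy
  simp [DD, this]

lemma col_inj {m n k : ℕ} {c : Fin m × Fin n → Fin k} (hc : IsLocatingColoring (GG m n) c)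
    (j : Fin n) : Function.Injective (fun r => c (r, j)) := by
  intro r s h
  by_contra h'
  exact hc.2.1 (r, j) (s, j) (by rw [gg_adj]; simp [DD, h']) h

lemma lower1 {m n k : ℕ} (hm : 3 ≤ m) (hn : 2 ≤ n) {c : Fin m × Fin n → Fin k}
    (hc : IsLocatingColoring (GG m n) c) : m + 1 ≤ k := by
  by_contra hk
  have h1 : m ≤ k := by
    simpa using Fintype.card_le_of_injective _ (col_inj hc ⟨0, by omega⟩)
  have : k = m := by omega
  subst this
  have hs : ∀ j, Function.Surjective (fun r => c (r, j)) := fun j =>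
    Finite.surjective_of_injective (col_inj hc j)
  obtain ⟨s, hs'⟩ := hs ⟨1, by omega⟩ (c (⟨0, by omega⟩, ⟨0, by omega⟩))
  have : ((⟨0, by omega⟩, ⟨0, by omega⟩) : Fin k × Fin n) = (s, ⟨1, by omega⟩) := by
    apply hc.2.2
    funext A
    by_cases hA : c (⟨0, by omega⟩, ⟨0, by omega⟩) = A
    · rw [← hA, code_self, ← hs', code_self]
    · obtain ⟨r1, h1⟩ := hs ⟨0, by omega⟩ A
      obtain ⟨r2, h2⟩ := hs ⟨1, by omega⟩ A
      rw [code_col c _ r1 _ A hA h1, code_col c _ r2 _ A (by rw [← hs'] at hA; exact hA) h2]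
  simp at this

section
variable {m n : ℕ} {c : Fin m × Fin n → Fin (m + 1)}

lemma col_other (hc : IsLocatingColoring (GG m n) c) {j : Fin n} {A : Fin (m + 1)}
    (hA : ∀ r, c (r, j) ≠ A) (B : Fin (m + 1)) (hB : B ≠ A) : ∃ r, c (r, j) = B := by
  by_contra h
  push Not at h
  have hcard : (Finset.univ.image (fun r => c (r, j))).card = m := by
    rw [Finset.card_image_of_injective _ (col_inj hc j)]; simp
  have hsub : Finset.univ.image (fun r => c (r, j)) ⊆ (Finset.univ.erase A).erase B := by
    intro x hx
    simp only [Finset.mem_image, Finset.mem_univ, true_and] at hx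
    obtain ⟨r, rfl⟩ := hx
    simp [h r, hA r]
  have := Finset.card_le_card hsub
  rw [hcard, Finset.card_erase_of_mem (by simp [hB]), Finset.card_erase_of_mem (by simp)] at this
  simp at this
  have := A.2
  have := B.2
  have : A.val ≠ B.val := fun h => hB (Fin.ext h.symm)
  omega

lemma key (hc : IsLocatingColoring (GG m n) c) {p q : Fin n} {A : Fin (m + 1)}
    (hp : ∀ r, c (r, p) ≠ A) (hq : ∀ r, c (r, q) ≠ A) (r s : Fin m)
    (he : c (r, p) = c (s, q))
    (h : colorCode (GG m n) c (r, p) A = colorCode (GG m n) c (s, q) A) : p = q := by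
  have : (r, p) = (s, q) := by
    apply hc.2.2
    funext B
    by_cases hA : B = A
    · rw [hA, h]
    by_cases hB : c (r, p) = B
    · rw [← hB, code_self, he, code_self]
    obtain ⟨r1, h1⟩ := col_other hc hp B hA
    obtain ⟨r2, h2⟩ := col_other hc hq B hA
    rw [code_col c _ r1 _ B hB h1, code_col c _ r2 _ B (by rw [← he]; exact hB) h2]
  exact (Prod.ext_iff.1 this).2

lemma code_two {p : Fin n} {A : Fin (m + 1)}
    (hp : ∀ r, c (r, p) ≠ A) (r : Fin m) (y : Fin m × Fin n) (hy : c y = A)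
    (hd : DD (r, p) y = 2)
    (hno : ∀ t : Fin n, t.val + 1 = p.val ∨ p.val + 1 = t.val → c (r, t) ≠ A) :
    colorCode (GG m n) c (r, p) A = 2 := by
  rw [← hd]
  apply code_eq c _ y A hy
  rintro ⟨s, t⟩ hz
  rw [hd]
  by_contra h'
  unfold DD at h'
  have htp : t ≠ p := by rintro rfl; exact hp s hz
  have htp' : t.val ≠ p.val := fun h => htp (Fin.ext h)
  have hrs : r = s := by
    by_contra h; simp [h] at h'; omega
  subst hrs
  simp at h'
  exact hno t (by omega) hz

lemma lem1 (hc : IsLocatingColoring (GG m n) c) {s p q : Fin n} {A : Fin (m + 1)}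
    (hp : ∀ r, c (r, p) ≠ A) (hq : ∀ r, c (r, q) ≠ A)
    (h3 : (s.val + 1 = p.val ∧ p.val + 1 = q.val) ∨ (q.val + 1 = p.val ∧ p.val + 1 = s.val))
    (r : Fin m) (hr : c (r, s) = A)
    (hq' : ∀ t : Fin n, t.val + 1 = q.val ∨ q.val + 1 = t.val → ∀ r, c (r, t) ≠ A) : False := by
  obtain ⟨r1, h1⟩ := col_other hc hp (c (r, q)) (hq r)
  have hne : r1 ≠ r := by
    rintro rfl
    refine hc.2.1 (r1, p) (r1, q) ?_ h1
    rw [gg_adj]; simp [DD]; omega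
  have : p = q := by
    apply key hc hp hq r1 r h1
    rw [code_two hp r1 (r, s) hr (by simp [DD, hne]; omega),
      code_two hq r (r, s) hr (by simp [DD]; omega) (fun t ht => hq' t ht r)]
    intro t ht ht2
    have : t = s ∨ t = q := by
      simp only [Fin.ext_iff]; omega
    rcases this with rfl | rfl
    · exact hne (col_inj hc t (ht2.trans hr.symm))
    · exact hq _ ht2
  subst this
  omega

lemma lem2 (hm : 3 ≤ m) (hc : IsLocatingColoring (GG m n) c) {p q p' q' : Fin n} {A : Fin (m + 1)}
    (hp : ∀ r, c (r, p) ≠ A) (hq : ∀ r, c (r, q) ≠ A) (hpq : p ≠ q)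
    (hpp : p.val + 1 = p'.val ∨ p'.val + 1 = p.val)
    (hqq : q.val + 1 = q'.val ∨ q'.val + 1 = q.val)
    (r s : Fin m) (hr : c (r, p') = A) (hs : c (s, q') = A)
    (hp' : ∀ t : Fin n, t ≠ p' → t.val + 1 = p.val ∨ p.val + 1 = t.val → ∀ r, c (r, t) ≠ A)
    (hq' : ∀ t : Fin n, t ≠ q' → t.val + 1 = q.val ∨ q.val + 1 = t.val → ∀ r, c (r, t) ≠ A) :
    False := by
  obtain ⟨B, hB⟩ : ∃ B, B ∉ ({A, c (r, p), c (s, q)} : Finset (Fin (m + 1))) := by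
    by_contra h
    push Not at h
    have h1 : (Finset.univ : Finset (Fin (m + 1))) ⊆ {A, c (r, p), c (s, q)} := fun x _ => h x
    have := (Finset.card_le_card h1).trans Finset.card_le_three
    simp at this
    omega
  simp only [Finset.mem_insert, Finset.mem_singleton, not_or] at hB
  obtain ⟨hBA, hB1, hB2⟩ := hB
  have aux : ∀ (p p' : Fin n) (r : Fin m), (∀ r, c (r, p) ≠ A) →
      (p.val + 1 = p'.val ∨ p'.val + 1 = p.val) → c (r, p') = A → B ≠ c (r, p) →
      (∀ t : Fin n, t ≠ p' → t.val + 1 = p.val ∨ p.val + 1 = t.val → ∀ r, c (r, t) ≠ A) →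
      ∃ r1, c (r1, p) = B ∧ colorCode (GG m n) c (r1, p) A = 2 := by
    intro p p' r hp hpp hr hB hp'
    obtain ⟨r1, h1⟩ := col_other hc hp B hBA
    have hne : r1 ≠ r := by rintro rfl; exact hB h1.symm
    refine ⟨r1, h1, code_two hp r1 (r, p') hr (by simp [DD, hne]; omega) ?_⟩
    intro t ht ht2
    by_cases h : t = p'
    · subst h; exact hne (col_inj hc t (ht2.trans hr.symm))
    · exact hp' t h ht _ ht2
  obtain ⟨r1, e1, f1⟩ := aux p p' r hp hpp hr hB1 hp'
  obtain ⟨r2, e2, f2⟩ := aux q q' s hq hqq hs hB2 hq'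
  exact hpq (key hc hp hq r1 r2 (e1.trans e2.symm) (f1.trans f2.symm))

lemma consec (hm : 3 ≤ m) (hc : IsLocatingColoring (GG m n) c) {i j : Fin n} {A : Fin (m + 1)}
    (hij : i.val + 1 = j.val) (hi : ∀ r, c (r, i) ≠ A) (hj : ∀ r, c (r, j) ≠ A) : False := by
  classical
  let H : ℕ → Prop := fun k => ∃ hk : k < n, ∃ r, c (r, ⟨k, hk⟩) = A
  have hH : ∀ {t : Fin n}, ¬ H t.val → ∀ r, c (r, t) ≠ A := fun {t} h r hr => h ⟨t.2, r, hr⟩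
  have hHi : ¬ H i.val := fun ⟨_, r, h⟩ => hi r h
  have hHj : ¬ H j.val := fun ⟨_, r, h⟩ => hj r h
  have left : (∃ k, k < i.val ∧ H k) → ∃ k, k < i.val ∧ H k ∧ ∀ t, k < t → t ≤ j.val → ¬ H t := by
    rintro ⟨k, hk, hk2⟩
    refine ⟨Nat.findGreatest H j.val, ?_, Nat.findGreatest_spec (P := H) (by omega) hk2, ?_⟩
    · have h1 := Nat.findGreatest_le (P := H) j.val
      have h2 := Nat.findGreatest_spec (P := H) (n := j.val) (by omega) hk2
      by_contra h3
      have : Nat.findGreatest H j.val = i.val ∨ Nat.findGreatest H j.val = j.val := by omega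
      rcases this with h | h <;> rw [h] at h2 <;> contradiction
    · intro t ht ht2
      exact Nat.findGreatest_is_greatest ht ht2
  have right : (∃ k, j.val < k ∧ H k) → ∃ k, j.val < k ∧ H k ∧ ∀ t, i.val ≤ t → t < k → ¬ H t := by
    intro h
    refine ⟨Nat.find h, (Nat.find_spec h).1, (Nat.find_spec h).2, ?_⟩
    intro t h1 h2 h3
    rcases lt_or_ge j.val t with h4 | h4
    · exact Nat.find_min h h2 ⟨h4, h3⟩
    · have : t = i.val ∨ t = j.val := by omega
      rcases this with rfl | rfl <;> contradiction
  by_cases hl : ∃ k, k < i.val ∧ H k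
  · obtain ⟨k, hk, ⟨hkn, r, hr⟩, hk3⟩ := left hl
    by_cases hr' : ∃ k, j.val < k ∧ H k
    · obtain ⟨l, hl, ⟨hln, s, hs⟩, hl3⟩ := right hr'
      have hmid : ∀ t, k < t → t < l → ¬ H t := by
        intro t h1 h2
        rcases le_or_gt t j.val with h | h
        · exact hk3 t h1 h
        · exact hl3 t (by omega) h2
      refine lem2 hm hc (p := ⟨k+1, by omega⟩) (q := ⟨l-1, by omega⟩) (p' := ⟨k, hkn⟩)
        (q' := ⟨l, hln⟩) (hH (hmid _ ?_ ?_)) (hH (hmid _ ?_ ?_)) ?_ ?_ ?_ r s hr hs ?_ ?_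
      any_goals simp
      any_goals omega
      · intro t h1 h2
        have : t.val ≠ k := fun h => h1 (Fin.ext h)
        exact hH (hmid _ (by omega) (by omega))
      · intro t h1 h2
        have : t.val ≠ l := fun h => h1 (Fin.ext h)
        exact hH (hmid _ (by omega) (by omega))
    · have hmid : ∀ t, k < t → ¬ H t := by
        intro t h1 h2
        rcases le_or_gt t j.val with h | h
        · exact hk3 t h1 h h2
        · exact hr' ⟨t, h, h2⟩
      refine lem1 hc (s := ⟨k, hkn⟩) (p := ⟨k+1, by omega⟩) (q := ⟨k+2, by omega⟩)
        (hH (hmid _ ?_)) (hH (hmid _ ?_)) ?_ r hr ?_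
      any_goals simp
      intro t h2
      exact hH (hmid _ (by omega))
  · obtain ⟨⟨s, l⟩, hs⟩ := hc.1 A
    have hHl : H l.val := ⟨l.2, s, hs⟩
    have hlj : j.val < l.val := by
      by_contra h
      have : l.val ≠ i.val := fun h => hHi (h ▸ hHl)
      have : l.val ≠ j.val := fun h => hHj (h ▸ hHl)
      exact hl ⟨l.val, by omega, hHl⟩
    obtain ⟨l, hl', ⟨hln, s, hs⟩, hl3⟩ := right ⟨_, hlj, hHl⟩
    have hmid : ∀ t, t < l → ¬ H t := by
      intro t h1 h2
      rcases lt_or_ge t i.val with h | h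
      · exact hl ⟨t, h, h2⟩
      · exact hl3 t h h1 h2
    refine lem1 hc (s := ⟨l, hln⟩) (p := ⟨l-1, by omega⟩) (q := ⟨l-2, by omega⟩)
        (hH (hmid _ ?_)) (hH (hmid _ ?_)) ?_ s hs ?_
    any_goals simp
    any_goals omega
    intro t h2
    exact hH (hmid _ (by omega))

lemma lower2 (hm : 3 ≤ m) (hn : 2 ≤ n) (hc : IsLocatingColoring (GG m n) c) : n ≤ m + 1 := by
  have hmiss : ∀ j : Fin n, ∃ A, ∀ r, c (r, j) ≠ A := by
    intro j
    by_contra h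
    push Not at h
    have := Fintype.card_le_of_surjective (fun r => c (r, j)) h
    simp at this
  have hcf : ∀ j : Fin n, ∃ r, ∀ B, B ≠ c (r, j) → colorCode (GG m n) c (r, j) B = 1 := by
    intro j
    obtain ⟨A, hA⟩ := hmiss j
    have : ∃ t : Fin n, (t.val + 1 = j.val ∨ j.val + 1 = t.val) := by
      rcases Nat.eq_zero_or_pos j.val with h | h
      · exact ⟨⟨1, by omega⟩, by right; simp [h]⟩
      · exact ⟨⟨j.val - 1, by omega⟩, by left; simp; omega⟩
    obtain ⟨t, ht⟩ := this
    have : ∃ r, c (r, t) = A := by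
      by_contra h
      push Not at h
      rcases ht with ht | ht
      · exact consec hm hc ht h hA
      · exact consec hm hc ht hA h
    obtain ⟨r, hr⟩ := this
    refine ⟨r, fun B hB => ?_⟩
    by_cases hBA : B = A
    · subst hBA
      exact code_one c _ (r, t) B hB.symm hr (by simp [DD]; omega)
    · obtain ⟨r1, h1⟩ := col_other hc hA B hBA
      exact code_col c _ r1 _ _ hB.symm h1
  choose g hg using hcf
  have hinj : Function.Injective (fun j => c (g j, j)) := by
    intro i j h
    simp only at h
    have : (g i, i) = (g j, j) := by
      apply hc.2.2
      funext B
      by_cases hB : B = c (g i, i)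
      · rw [hB, code_self, h, code_self]
      · rw [hg i B hB, hg j B (by rw [← h]; exact hB)]
    exact (Prod.ext_iff.1 this).2
  simpa using Fintype.card_le_of_injective _ hinj

end

lemma emod_cases (x N : ℕ) (h : x < 2 * N) (hN : 0 < N) :
    (x < N ∧ x % N = x) ∨ (N ≤ x ∧ x % N = x - N) := by
  rcases lt_or_ge x N with h1 | h1
  · left; exact ⟨h1, Nat.mod_eq_of_lt h1⟩
  · right; refine ⟨h1, ?_⟩
    rw [Nat.mod_eq_sub_mod h1, Nat.mod_eq_of_lt (by omega)]

/-- offset of the color in construction 1 -/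
def off (m r j : ℕ) : ℕ :=
  if 3 ≤ r then r else if r = j % 3 then 2 else if r = (j + 1) % 3 then 1 else m

lemma off_inj {m r s j : ℕ} (hm : 3 ≤ m) (hr : r < m) (hs : s < m) (h : off m r j = off m s j) :
    r = s := by
  unfold off at h
  split_ifs at h <;> omega

lemma off_pos {m r j : ℕ} (hm : 3 ≤ m) (hr : r < m) : 1 ≤ off m r j ∧ off m r j ≤ m := by
  unfold off
  split_ifs <;> omega

def c1 (m n : ℕ) (x : Fin m × Fin n) : Fin (m + 1) :=
  ⟨(x.2.val + off m x.1.val x.2.val) % (m + 1), Nat.mod_lt _ (by omega)⟩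

lemma c1_val {m n : ℕ} (hm : 3 ≤ m) (hn : n ≤ m + 1) (x : Fin m × Fin n) :
    (x.2.val + off m x.1.val x.2.val < m + 1 ∧
      (c1 m n x).val = x.2.val + off m x.1.val x.2.val) ∨
    (m + 1 ≤ x.2.val + off m x.1.val x.2.val ∧
      (c1 m n x).val = x.2.val + off m x.1.val x.2.val - (m + 1)) := by
  have := off_pos (j := x.2.val) hm x.1.2
  have := x.2.2
  exact emod_cases _ (m + 1) (by omega) (by omega)

lemma c1_miss {m n : ℕ} (hm : 3 ≤ m) (hn : n ≤ m + 1) (r : Fin m) (j : Fin n) :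
    (c1 m n (r, j)).val ≠ j.val := by
  have h1 := c1_val hm hn (r, j)
  have := off_pos (j := j.val) hm r.2
  simp only at h1
  omega

lemma c1_inj {m n : ℕ} (hm : 3 ≤ m) (hn : n ≤ m + 1) (j : Fin n) :
    Function.Injective (fun r => c1 m n (r, j)) := by
  intro r s h
  have h1 := c1_val hm hn (r, j)
  have h2 := c1_val hm hn (s, j)
  have h3 := off_pos (j := j.val) hm r.2
  have h4 := off_pos (j := j.val) hm s.2
  have h5 := Fin.ext_iff.1 h
  simp only at h1 h2 h5
  have := j.2
  exact Fin.ext (off_inj (j := j.val) hm r.2 s.2 (by omega))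

lemma c1_other {m n : ℕ} (hm : 3 ≤ m) (hn : n ≤ m + 1) (j : Fin n)
    (B : Fin (m + 1)) (hB : B.val ≠ j.val) : ∃ r, c1 m n (r, j) = B := by
  by_contra h
  push Not at h
  have hcard : (Finset.univ.image (fun r => c1 m n (r, j))).card = m := by
    rw [Finset.card_image_of_injective _ (c1_inj hm hn j)]; simp
  have hlt : j.val < m + 1 := by omega
  have hsub : Finset.univ.image (fun r => c1 m n (r, j)) ⊆
      (Finset.univ.erase ⟨j.val, hlt⟩).erase B := by
    intro x hx
    simp only [Finset.mem_image, Finset.mem_univ, true_and] at hx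
    obtain ⟨r, rfl⟩ := hx
    have := c1_miss hm hn r j
    simp [h r, Fin.ext_iff, this]
  have := Finset.card_le_card hsub
  rw [hcard, Finset.card_erase_of_mem (by simp [Fin.ext_iff, hB]),
    Finset.card_erase_of_mem (by simp)] at this
  simp at this
  omega

lemma c1_step {m n : ℕ} (hm : 3 ≤ m) (hn : n ≤ m + 1) (r : Fin m) (i j : Fin n)
    (hij : i.val + 1 = j.val) : c1 m n (r, i) ≠ c1 m n (r, j) := by
  intro h
  have h1 := c1_val hm hn (r, i)
  have h2 := c1_val hm hn (r, j)
  have h5 := Fin.ext_iff.1 h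
  have := r.2
  have := j.2
  simp only at h1 h2
  rw [← hij] at h2
  unfold off at h1 h2
  split_ifs at h1 h2 <;> omega

lemma c1_col {m n : ℕ} (hm : 3 ≤ m) (hn : n ≤ m + 1) (r : Fin m) (j t : Fin n)
    (ht : t.val + 1 = j.val ∨ j.val + 1 = t.val) (h : (c1 m n (r, t)).val = j.val) :
    off m r.val j.val = 2 := by
  have h1 := c1_val hm hn (r, t)
  have := r.2
  have := j.2
  have := t.2
  simp only at h1
  rcases ht with ht | ht
  · rw [← ht] at h ⊢
    unfold off at h1 ⊢
    split_ifs at h1 ⊢ <;> omega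
  · rw [← ht] at h1
    unfold off at h1 ⊢
    split_ifs at h1 ⊢ <;> omega

lemma proper_of {m n k : ℕ} (c : Fin m × Fin n → Fin k)
    (h1 : ∀ j, Function.Injective (fun r => c (r, j)))
    (h2 : ∀ (r : Fin m) (i j : Fin n), i.val + 1 = j.val → c (r, i) ≠ c (r, j)) :
    ∀ u v, (GG m n).Adj u v → c u ≠ c v := by
  rintro ⟨r, i⟩ ⟨s, j⟩ h
  rw [gg_adj] at h
  simp only [DD] at h
  by_cases hrs : r = s
  · subst hrs
    simp at h
    rcases lt_or_ge i.val j.val with h' | h'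
    · exact h2 r i j (by omega)
    · exact (h2 r j i (by omega)).symm
  · simp only [hrs, if_false] at h
    have : i = j := Fin.ext (by omega)
    subst this
    exact fun e => hrs (h1 i e)

lemma upper1 {m n : ℕ} (hm : 3 ≤ m) (hn : 2 ≤ n) (hn2 : n ≤ m + 1) :
    IsLocatingColoring (GG m n) (c1 m n) := by
  refine ⟨?_, proper_of _ (c1_inj hm hn2) (c1_step hm hn2), ?_⟩
  · intro B
    by_cases hB : B.val = 0
    · obtain ⟨r, h⟩ := c1_other hm hn2 ⟨1, by omega⟩ B (by simp [hB])
      exact ⟨_, h⟩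
    · obtain ⟨r, h⟩ := c1_other hm hn2 ⟨0, by omega⟩ B (by simpa using hB)
      exact ⟨_, h⟩
  · have aux : ∀ (r s : Fin m) (i j : Fin n), i ≠ j → c1 m n (r, i) = c1 m n (s, j) →
        colorCode (GG m n) (c1 m n) (r, i) = colorCode (GG m n) (c1 m n) (s, j) →
        off m r.val i.val = 2 := by
      intro r s i j hij hc he
      have hij' : i.val ≠ j.val := fun h => hij (Fin.ext h)
      have hlt : i.val < m + 1 := by omega
      obtain ⟨s1, hs1⟩ := c1_other hm hn2 j ⟨i.val, hlt⟩ hij'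
      have e1 : colorCode (GG m n) (c1 m n) (s, j) ⟨i.val, hlt⟩ = 1 := by
        apply code_col _ s s1 j _ _ hs1
        rw [← hc]
        intro h
        exact c1_miss hm hn2 r i (by rw [h])
      obtain ⟨⟨z, t⟩, hz, hz2⟩ := code_ex (c1 m n) (r, i) (s1, j)
      rw [hs1] at hz hz2
      rw [he, e1] at hz2
      have hzv := Fin.ext_iff.1 hz
      simp only at hzv
      have hti : t.val ≠ i.val := by
        intro h
        have : t = i := Fin.ext h
        subst this
        exact c1_miss hm hn2 z t hzv
      have hrz : r = z := by
        by_contra h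
        simp [DD, h] at hz2
        omega
      subst hrz
      simp [DD] at hz2
      exact c1_col hm hn2 r i t (by omega) hzv
    rintro ⟨r, i⟩ ⟨s, j⟩ he
    have hc : c1 m n (r, i) = c1 m n (s, j) := by
      have h0 := code_self (c1 m n) (r, i)
      rw [he] at h0
      obtain ⟨z, hz, hz2⟩ := code_ex (c1 m n) (s, j) (r, i)
      rw [h0] at hz2
      rw [DD_zero hz2.symm, hz]
    by_cases hij : i = j
    · subst hij
      rw [c1_inj hm hn2 i hc]
    · exfalso
      have e1 := aux r s i j hij hc he
      have e2 := aux s r j i (Ne.symm hij) hc.symm he.symm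
      have h1 := c1_val hm hn2 (r, i)
      have h2 := c1_val hm hn2 (s, j)
      have h5 := Fin.ext_iff.1 hc
      simp only [e1, e2] at h1 h2
      have : i.val ≠ j.val := fun h => hij (Fin.ext h)
      have := i.2
      have := j.2
      omega

/-- base color of construction 2 : `r - j` modulo `m + 1` -/
def b2 (m r j : ℕ) : ℕ := (r + m * j) % (m + 1)

lemma b2_lt (m r j : ℕ) : b2 m r j < m + 1 := Nat.mod_lt _ (by omega)

lemma b2_zero {m r : ℕ} (hr : r < m + 1) : b2 m r 0 = r := by
  simp [b2, Nat.mod_eq_of_lt hr]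

lemma b2_succ (m r j : ℕ) : b2 m r (j + 1) = (b2 m r j + m) % (m + 1) := by
  simp only [b2, Nat.mod_add_mod]
  congr 1; ring

lemma b2_succ' (m r j : ℕ) : (b2 m r j = 0 ∧ b2 m r (j + 1) = m) ∨
    (b2 m r j ≠ 0 ∧ b2 m r (j + 1) + 1 = b2 m r j) := by
  have := b2_lt m r j
  have h := emod_cases (b2 m r j + m) (m + 1) (by omega) (by omega)
  rw [← b2_succ] at h
  omega

lemma b2_inj {m r s j : ℕ} (hr : r < m) (hs : s < m) (h : b2 m r j = b2 m s j) : r = s := by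
  induction j with
  | zero => rwa [b2_zero (by omega), b2_zero (by omega)] at h
  | succ j ih =>
    apply ih
    have := b2_succ' m r j
    have := b2_succ' m s j
    have := b2_lt m r j
    have := b2_lt m s j
    omega

lemma b2_diag {m r j : ℕ} (hm : 3 ≤ m) (hr : r < m) : b2 m 0 (j + 1) ≠ b2 m r j := by
  have key : ∀ j, b2 m 0 (j + 1) = b2 m m j := by
    intro j
    simp only [b2]; congr 1; ring
  rw [key]
  induction j with
  | zero => rw [b2_zero (by omega), b2_zero (by omega)]; omega
  | succ j ih =>
    intro h
    apply ih
    have := b2_succ' m r j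
    have := b2_succ' m m j
    have := b2_lt m r j
    have := b2_lt m m j
    omega

def c2 (m n : ℕ) (x : Fin m × Fin n) : Fin (m + 2) :=
  if x.1.val = 0 ∧ x.2.val = 0 then ⟨m + 1, by omega⟩ else
    ⟨b2 m x.1.val x.2.val, by have := b2_lt m x.1.val x.2.val; omega⟩

lemma c2_val {m n : ℕ} (x : Fin m × Fin n) :
    (x.1.val = 0 ∧ x.2.val = 0 ∧ (c2 m n x).val = m + 1) ∨
    (¬ (x.1.val = 0 ∧ x.2.val = 0) ∧ (c2 m n x).val = b2 m x.1.val x.2.val) := by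
  unfold c2
  split_ifs with h
  · left; exact ⟨h.1, h.2, rfl⟩
  · right; exact ⟨h, rfl⟩

lemma upper2 {m n : ℕ} (hm : 3 ≤ m) (hn : 2 ≤ n) :
    IsLocatingColoring (GG m n) (c2 m n) := by
  have hinj : ∀ j, Function.Injective (fun r => c2 m n (r, j)) := by
    intro j r s h
    have h1 := c2_val (r, j)
    have h2 := c2_val (s, j)
    have h3 := Fin.ext_iff.1 h
    have h4 := b2_lt m r.val j.val
    have h5 := b2_lt m s.val j.val
    have h6 := b2_inj (j := j.val) r.2 s.2
    simp only at h1 h2 h3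
    apply Fin.ext
    by_cases h : b2 m r.val j.val = b2 m s.val j.val
    · exact h6 h
    · omega
  refine ⟨?_, proper_of _ hinj ?_, ?_⟩
  · intro B
    have hBlt := B.2
    by_cases h1 : B.val = m + 1
    · refine ⟨(⟨0, by omega⟩, ⟨0, by omega⟩), Fin.ext ?_⟩
      simp [c2, h1]
    by_cases h2 : B.val = m
    · refine ⟨(⟨0, by omega⟩, ⟨1, by omega⟩), Fin.ext ?_⟩
      simp [c2, h2, b2]
    by_cases h3 : B.val = 0
    · refine ⟨(⟨1, by omega⟩, ⟨1, by omega⟩), Fin.ext ?_⟩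
      simp [c2, h3, b2, Nat.add_comm]
    · refine ⟨(⟨B.val, by omega⟩, ⟨0, by omega⟩), Fin.ext ?_⟩
      simp only [c2, h3, false_and, if_false]
      exact b2_zero (by omega)
  · intro r i j hij h
    have h1 := c2_val (r, i)
    have h2 := c2_val (r, j)
    have h3 := Fin.ext_iff.1 h
    have h4 := b2_lt m r.val i.val
    have h5 := b2_lt m r.val j.val
    have h6 := b2_succ' m r.val i.val
    simp only at h1 h2
    rw [hij] at h6
    omega
  · let o : Fin m × Fin n := (⟨0, by omega⟩, ⟨0, by omega⟩)
    have hd : ∀ v, colorCode (GG m n) (c2 m n) v (c2 m n o) = DD v o := by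
      intro v
      apply code_eq _ _ o _ rfl
      intro z hz
      have h1 := c2_val z
      have h2 := c2_val o
      have h3 := Fin.ext_iff.1 hz
      have h4 := b2_lt m z.1.val z.2.val
      have : z = o := by
        apply Prod.ext <;> apply Fin.ext <;> simp [o] at h2 h3 ⊢ <;> omega
      rw [this]
    have hdv : ∀ r j, DD (r, j) o = (if r.val = 0 then 0 else 1) + j.val := by
      intro r j
      simp [DD, o, Fin.ext_iff]
    rintro ⟨r, i⟩ ⟨s, j⟩ he
    have hc : c2 m n (r, i) = c2 m n (s, j) := by
      have h0 := code_self (c2 m n) (r, i)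
      rw [he] at h0
      obtain ⟨z, hz, hz2⟩ := code_ex (c2 m n) (s, j) (r, i)
      rw [h0] at hz2
      rw [DD_zero hz2.symm, hz]
    have e := congrFun he (c2 m n o)
    rw [hd, hd, hdv, hdv] at e
    by_cases hij : i.val = j.val
    · have : i = j := Fin.ext hij
      subst this
      rw [hinj i hc]
    · exfalso
      have h1 := c2_val (r, i)
      have h2 := c2_val (s, j)
      have h3 := Fin.ext_iff.1 hc
      have h4 := b2_lt m r.val i.val
      have h5 := b2_lt m s.val j.val
      have h6 := b2_diag (j := j.val) hm s.2
      have h7 := b2_diag (j := i.val) hm r.2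
      simp only at h1 h2
      split_ifs at e with hr hs hs
      · omega
      · have : i.val = j.val + 1 := by omega
        rw [← this] at h6
        rw [hr] at h1 h4
        omega
      · have : j.val = i.val + 1 := by omega
        rw [← this] at h7
        rw [hs] at h2 h5
        omega
      · omega

/-- For `m ≥ 3` and `n ≥ 2`, `χ_L(K_m □ P_n) = m + 2` if `m ≤ n - 2`
and `χ_L(K_m □ P_n) = m + 1` if `m ≥ n - 1`. -/
theorem stmt7 (m n : ℕ) (hm : 3 ≤ m) (hn : 2 ≤ n) :
    (m + 2 ≤ n →
      locatingChromaticNumber ((⊤ : SimpleGraph (Fin m)) □ pathGraph n) = m + 2) ∧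
    (n ≤ m + 1 →
      locatingChromaticNumber ((⊤ : SimpleGraph (Fin m)) □ pathGraph n) = m + 1) := by
  constructor
  · intro h
    refine IsLeast.csInf_eq ⟨⟨c2 m n, upper2 hm hn⟩, ?_⟩
    rintro k ⟨c, hc⟩
    have h1 := lower1 hm hn hc
    by_contra h2
    have : k = m + 1 := by omega
    subst this
    have := lower2 hm hn hc
    omega
  · intro h
    refine IsLeast.csInf_eq ⟨⟨c1 m n, upper1 hm hn h⟩, ?_⟩
    rintro k ⟨c, hc⟩
    exact lower1 hm hn hc
end

section
/- Let n ≥ 3 be an integer and let m_0 = max{k ∈ ℕ : k(k−1) − 1 ≤ n}. If m_0 ≥ 4 and (m_0(m_0−1) − 1) + (m_0 − 2) ≤ n < (m_0+1)m_0 − 1, then the locating chromatic number of K_{m_0} □ K_n equals n + 1. -/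
open SimpleGraph

lemma hall_row {ι J S : Type*} [Fintype ι] [Fintype J] [Fintype S] (m : ℕ)
    (R : ι → J → S → Prop) (hι : Fintype.card ι = m)
    (hJS : Fintype.card J = Fintype.card S)
    (hN : 4 * m ≤ Fintype.card S + 3) (hm : 1 ≤ m)
    (hf : ∀ i j s s', R i j s → R i j s' → s = s')
    (hr : ∀ i j j' s, R i j s → R i j' s → j = j')
    (r : ι) (U : Finset J) (hU : ∀ j s, R r j s → j ∈ U) (hUc : U.card + 1 ≤ 2 * m) :
    ∃ f : J → S, Function.Bijective f ∧ (∀ j s, R r j s → f j = s) ∧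
      ∀ i j, (∀ s, ¬ R r j s) → ¬ R i j (f j) := by
  classical
  let UJ : Finset J := Finset.univ.filter fun j => ∃ s, R r j s
  let US : Finset S := Finset.univ.filter fun s => ∃ j, R r j s
  have hUJ : UJ.card ≤ U.card := Finset.card_le_card (by
    intro j hj
    simp only [UJ, Finset.mem_filter, Finset.mem_univ, true_and] at hj
    obtain ⟨s, hs⟩ := hj
    exact hU j s hs)
  have hUS : US.card ≤ UJ.card := by
    refine Finset.card_le_card_of_forall_subsingleton (fun s j => R r j s) ?_ ?_
    · intro s hs
      simp only [US, Finset.mem_filter, Finset.mem_univ, true_and] at hs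
      obtain ⟨j, hj⟩ := hs
      exact ⟨j, by simpa [UJ] using ⟨s, hj⟩, hj⟩
    · rintro j - s ⟨_, h1⟩ s' ⟨_, h2⟩
      exact hf _ _ _ _ h1 h2
  have hUSc := Finset.card_compl US
  have hUJc := Finset.card_compl UJ
  have hUSle := Finset.card_le_univ US
  have hUJle := Finset.card_le_univ UJ
  let t : {j : J // j ∈ UJᶜ} → Finset S := fun j => USᶜ.filter fun s => ∀ i, ¬ R i j s
  have hrow : (Finset.univ.erase r : Finset ι).card = m - 1 := by
    rw [Finset.card_erase_of_mem (Finset.mem_univ _), Finset.card_univ, hι]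
  have hall : ∀ A : Finset {j : J // j ∈ UJᶜ}, A.card ≤ (A.biUnion t).card := by
    intro A
    by_cases hA : A.card ≤ m - 1
    · rcases A.eq_empty_or_nonempty with rfl | ⟨a, ha⟩
      · simp
      have h1 : (t a).card ≤ (A.biUnion t).card :=
        Finset.card_le_card (Finset.subset_biUnion_of_mem t ha)
      have h2 : (USᶜ \ t a).card ≤ (Finset.univ.erase r : Finset ι).card := by
        refine Finset.card_le_card_of_forall_subsingleton (fun s i => R i a s) ?_ ?_
        · intro s hs
          simp only [t, Finset.mem_sdiff, Finset.mem_filter, not_and, not_forall, not_not] at hs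
          obtain ⟨i, hi⟩ := hs.2 hs.1
          refine ⟨i, ?_, hi⟩
          simp only [Finset.mem_erase, Finset.mem_univ, and_true]
          rintro rfl
          have := hs.1
          simp only [US, Finset.mem_compl, Finset.mem_filter, Finset.mem_univ, true_and] at this
          exact this ⟨_, hi⟩
        · rintro j - s ⟨_, h1⟩ s' ⟨_, h2⟩
          exact hf _ _ _ _ h1 h2
      have h3 : (USᶜ \ t a).card + (t a).card = USᶜ.card :=
        Finset.card_sdiff_add_card_eq_card (Finset.filter_subset _ _)
      omega
    · have h1 : USᶜ ⊆ A.biUnion t := by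
        intro s hs
        by_contra hcon
        apply hA
        rw [← hrow]
        refine Finset.card_le_card_of_forall_subsingleton (fun (a : {j : J // j ∈ UJᶜ}) (i : ι) => R i a.1 s) ?_ ?_
        · intro a ha
          have : s ∉ t a := fun h => hcon (Finset.mem_biUnion.2 ⟨a, ha, h⟩)
          simp only [t, Finset.mem_filter, not_and, not_forall, not_not] at this
          obtain ⟨i, hi⟩ := this hs
          refine ⟨i, ?_, hi⟩
          simp only [Finset.mem_erase, Finset.mem_univ, and_true]
          rintro rfl
          simp only [US, Finset.mem_compl, Finset.mem_filter, Finset.mem_univ, true_and] at hs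
          exact hs ⟨_, hi⟩
        · rintro i - a ⟨_, h1⟩ a' ⟨_, h2⟩
          exact Subtype.ext (hr _ _ _ _ h1 h2)
      have h2 := Finset.card_le_card h1
      have h3 : A.card ≤ UJᶜ.card := by
        have := Finset.card_le_univ A
        rwa [Fintype.card_coe] at this
      omega
  obtain ⟨g, hginj, hg⟩ := (Finset.all_card_le_biUnion_card_iff_exists_injective t).1 hall
  let f : J → S := fun j => if h : ∃ s, R r j s then h.choose else g ⟨j, by simpa [UJ] using h⟩
  have hf1 : ∀ j s, R r j s → f j = s := by
    intro j s h
    have h' : ∃ s, R r j s := ⟨s, h⟩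
    simp only [f, dif_pos h']
    exact hf _ _ _ _ h'.choose_spec h
  have hf2 : ∀ j (h : ¬ ∃ s, R r j s), f j = g ⟨j, by simpa [UJ] using h⟩ := by
    intro j h
    simp only [f, dif_neg h]
  have hg1 : ∀ j, ∀ j', ¬ R r j' (g j) := by
    intro j j' h
    have := hg j
    simp only [t, US, Finset.mem_compl, Finset.mem_filter, Finset.mem_univ, true_and] at this
    exact this.1 ⟨_, h⟩
  refine ⟨f, ?_, hf1, ?_⟩
  · rw [Fintype.bijective_iff_injective_and_card]
    refine ⟨?_, hJS⟩
    intro j j' hjj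
    by_cases h : ∃ s, R r j s <;> by_cases h' : ∃ s, R r j' s
    · obtain ⟨s, hs⟩ := h
      obtain ⟨s', hs'⟩ := h'
      rw [hf1 _ _ hs, hf1 _ _ hs'] at hjj
      subst hjj
      exact hr _ _ _ _ hs hs'
    · obtain ⟨s, hs⟩ := h
      rw [hf1 _ _ hs, hf2 _ h'] at hjj
      subst hjj
      exact absurd hs (hg1 _ _)
    · obtain ⟨s, hs⟩ := h'
      rw [hf1 _ _ hs, hf2 _ h] at hjj
      subst hjj
      exact absurd hs (hg1 _ _)
    · rw [hf2 _ h, hf2 _ h'] at hjj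
      simpa using hginj hjj
  · intro i j h
    have h' : ¬ ∃ s, R r j s := by simpa using h
    rw [hf2 _ h']
    have := hg ⟨j, by simpa [UJ] using h'⟩
    simp only [t, Finset.mem_filter] at this
    exact this.2 i

lemma hall_complete {ι J S : Type*} [Fintype ι] [Fintype J] [Fintype S] (m : ℕ)
    (R : ι → J → S → Prop) (hι : Fintype.card ι = m)
    (hJS : Fintype.card J = Fintype.card S)
    (hN : 4 * m ≤ Fintype.card S + 3) (hm : 1 ≤ m)
    (hf : ∀ i j s s', R i j s → R i j s' → s = s')
    (hr : ∀ i j j' s, R i j s → R i j' s → j = j')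
    (hc : ∀ i i' j s, R i j s → R i' j s → i = i')
    (U : ι → Finset J) (hU : ∀ r j s, R r j s → j ∈ U r) (hUc : ∀ r, (U r).card + 1 ≤ 2 * m) :
    ∃ L : ι → J → S, (∀ i, Function.Bijective (L i)) ∧ (∀ i j s, R i j s → L i j = s) ∧
      ∀ i i' j, L i j = L i' j → i = i' := by
  classical
  have key : ∀ A : Finset ι, ∃ Q : ι → J → S → Prop,
      (∀ i j s s', Q i j s → Q i j s' → s = s') ∧
      (∀ i j j' s, Q i j s → Q i j' s → j = j') ∧
      (∀ i i' j s, Q i j s → Q i' j s → i = i') ∧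
      (∀ i j s, R i j s → Q i j s) ∧
      (∀ i ∉ A, ∀ j s, Q i j s → R i j s) ∧
      (∀ i ∈ A, (∀ j, ∃ s, Q i j s) ) := by
    intro A
    induction A using Finset.induction_on with
    | empty => exact ⟨R, hf, hr, hc, fun _ _ _ h => h, fun _ _ _ _ h => h, by simp⟩
    | insert r A hrA ih =>
      obtain ⟨Q, q1, q2, q3, q4, q5, q6⟩ := ih
      obtain ⟨f, f1, f2, f3⟩ := hall_row m Q hι hJS hN hm q1 q2 r (U r)
        (fun j s h => hU r j s (q5 r hrA j s h)) (hUc r)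
      have f4 : ∀ i j, Q i j (f j) → i ≠ r → False := by
        intro i j h hir
        by_cases h' : ∃ s, Q r j s
        · obtain ⟨s, hs⟩ := h'
          have := f2 j s hs
          subst this
          exact hir (q3 _ _ _ _ h hs)
        · exact f3 i j (by simpa using h') h
      refine ⟨fun i j s => if i = r then f j = s else Q i j s, ?_, ?_, ?_, ?_, ?_, ?_⟩
      · intro i j s s' h h'
        by_cases hi : i = r
        · simp only [hi, if_true] at h h'; exact h.symm.trans h'
        · simp only [hi, if_false] at h h'; exact q1 _ _ _ _ h h'
      · intro i j j' s h h'
        by_cases hi : i = r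
        · simp only [hi, if_true] at h h'; exact f1.1 (h.trans h'.symm)
        · simp only [hi, if_false] at h h'; exact q2 _ _ _ _ h h'
      · intro i i' j s h h'
        by_cases hi : i = r <;> by_cases hi' : i' = r
        · rw [hi, hi']
        · simp only [hi, hi', if_true, if_false] at h h'
          subst h
          exact (f4 _ _ h' hi').elim
        · simp only [hi, hi', if_true, if_false] at h h'
          subst h'
          exact (f4 _ _ h hi).elim
        · simp only [hi, hi', if_false] at h h'; exact q3 _ _ _ _ h h'
      · intro i j s h
        by_cases hi : i = r
        · subst hi; simp only [if_true]; exact f2 _ _ (q4 _ _ _ h)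
        · simp only [hi, if_false]; exact q4 _ _ _ h
      · intro i hi j s h
        simp only [Finset.mem_insert, not_or] at hi
        simp only [hi.1, if_false] at h
        exact q5 i hi.2 j s h
      · intro i hi j
        by_cases hir : i = r
        · simp [hir]
        · simp only [hir, if_false]
          exact q6 i (by simpa [hir] using hi) j
  obtain ⟨Q, q1, q2, q3, q4, -, q6⟩ := key Finset.univ
  choose L hL using fun i => q6 i (Finset.mem_univ i)
  refine ⟨L, fun i => ?_, fun i j s h => q1 _ _ _ _ (hL i j) (q4 _ _ _ h), fun i i' j h => ?_⟩
  · rw [Fintype.bijective_iff_injective_and_card]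
    refine ⟨fun j j' h => ?_, hJS⟩
    have h1 := hL i j
    rw [h] at h1
    exact q2 _ _ _ _ h1 (hL i j')
  · have h1 := hL i j
    rw [h] at h1
    exact q3 _ _ _ _ h1 (hL i' j)

lemma exists_cx (m n : ℕ) (hm : 4 ≤ m) (hn : m * m ≤ n + 3) (sp : Fin m → Fin (n+1))
    (hsp : ∀ a, (sp a).val = a.val) :
    ∃ c x : Fin m → Fin m → Fin (n+1),
      (∀ a b, a ≠ b → c a b ≠ 0) ∧
      (∀ a b a' b', a ≠ b → a' ≠ b' → x a b = x a' b' → a = a' ∧ b = b') ∧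
      (∀ a b a' b', a ≠ b → a' ≠ b' → c a b = c a' b' →
        (a = a' ∧ b = b') ∨ (a = b' ∧ b = a' ∧ x a b = sp a ∧ x b a = sp b)) ∧
      (∀ a b d, a ≠ b → x a b = sp d → d = a ∧ c a b = c b a ∧ x b a = sp b) := by
  classical
  let z : Fin m := ⟨0, by omega⟩
  let w : Fin m := ⟨1, by omega⟩
  have hzw : z ≠ w := by simp [z, w]
  have hz : z.val = 0 := rfl
  have hw : w.val = 1 := rfl
  let P : Finset (Fin m × Fin m) := (Finset.univ : Finset (Fin m)).offDiag \ {(z, w), (w, z)}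
  have hP : P.card + m + 2 = m * m := by
    have h1 : P.card + ({(z, w), (w, z)} : Finset (Fin m × Fin m)).card =
        (Finset.univ : Finset (Fin m)).offDiag.card := by
      apply Finset.card_sdiff_add_card_eq_card
      intro p hp
      simp only [Finset.mem_insert, Finset.mem_singleton] at hp
      rcases hp with rfl | rfl <;> simp [hzw, hzw.symm]
    rw [Finset.offDiag_card, Finset.card_pair (by simp [hzw]), Finset.card_univ, Fintype.card_fin] at h1
    have : 4 * m ≤ m * m := Nat.mul_le_mul_right _ hm
    omega
  let e := P.equivFin
  have hmem : ∀ a b, a ≠ b → ¬ (a = z ∧ b = w) → ¬ (a = w ∧ b = z) → (a, b) ∈ P := by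
    intro a b h1 h2 h3
    simp only [P, Finset.mem_sdiff, Finset.mem_offDiag, Finset.mem_univ, true_and, ne_eq, h1,
      not_false_eq_true, Finset.mem_insert, Finset.mem_singleton, Prod.mk.injEq, not_or]
    exact ⟨h2, h3⟩
  obtain ⟨E, hE1, hE2⟩ : ∃ E : Fin m → Fin m → ℕ, (∀ a b, E a b + m < n + 1) ∧
      ∀ a b a' b', (a, b) ∈ P → (a', b') ∈ P → E a b = E a' b' → a = a' ∧ b = b' := by
    have hmm : 4 * m ≤ m * m := Nat.mul_le_mul_right _ hm
    refine ⟨fun a b => if h : (a, b) ∈ P then (e ⟨_, h⟩).val else 0, ?_, ?_⟩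
    · intro a b
      by_cases h : (a, b) ∈ P
      · have := (e ⟨_, h⟩).isLt
        simp only [h, dif_pos]
        omega
      · simp only [h, dif_neg, not_false_eq_true]; omega
    · intro a b a' b' h h' hE
      simp only [h, h', dif_pos] at hE
      have := e.injective (Fin.ext hE)
      simpa using this
  refine ⟨fun a b => if (a = z ∧ b = w) ∨ (a = w ∧ b = z) then ⟨1, by omega⟩ else
      ⟨E a b + 2, by have := hE1 a b; omega⟩,
    fun a b => if (a = z ∧ b = w) ∨ (a = w ∧ b = z) then sp a else
      ⟨E a b + m, hE1 a b⟩, ?_, ?_, ?_, ?_⟩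
  · intro a b h
    dsimp only
    split_ifs <;> simp [Fin.ext_iff]
  · intro a b a' b' h h' hx
    have := a.isLt
    have := a'.isLt
    dsimp only at hx
    split_ifs at hx <;> simp only [Fin.ext_iff, hsp] at hx
    · grind
    · omega
    · omega
    · have := hE2 a b a' b'
      grind
  · intro a b a' b' h h' hx
    have := hE2 a b a' b'
    dsimp only at hx ⊢
    split_ifs at hx <;> simp only [Fin.ext_iff] at hx
    · grind
    · omega
    · omega
    · grind
  · intro a b d h hx
    have := d.isLt
    dsimp only at hx ⊢
    split_ifs at hx with h1 <;> simp only [Fin.ext_iff, hsp] at hx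
    · have h2 : (b = z ∧ a = w) ∨ (b = w ∧ a = z) := by tauto
      simp only [h1, h2, if_true, and_self, and_true]
      exact Fin.ext hx.symm
    · omega

lemma exists_array (m n : ℕ) (hm : 4 ≤ m) (hn : m * m ≤ n + 3) :
    ∃ (L : Fin m → Fin (n+1) → Fin (n+1)) (sp : Fin m → Fin (n+1))
      (c x : Fin m → Fin m → Fin (n+1)), (∀ i, Function.Bijective (L i)) ∧
      (∀ i i' j, L i j = L i' j → i = i') ∧
      Function.Injective sp ∧ (∀ i, L i 0 = sp i) ∧
      (∀ a b a' b', a ≠ b → a' ≠ b' → x a b = x a' b' → b = b') ∧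
      (∀ a b, a ≠ b → L a (c a b) = sp b) ∧
      (∀ a b, a ≠ b → L b (c a b) = x a b) := by
  classical
  have hmm : 4 * m ≤ m * m := Nat.mul_le_mul_right _ hm
  let sp : Fin m → Fin (n+1) := fun a => ⟨a.val, by have := a.isLt; omega⟩
  have hsp : Function.Injective sp := fun a b h => Fin.ext (by simpa [sp] using h)
  obtain ⟨c, x, hc0, hx, hc, hxs⟩ := exists_cx m n hm hn sp (fun a => rfl)
  let R : Fin m → Fin (n+1) → Fin (n+1) → Prop := fun a j s =>
    (j = 0 ∧ s = sp a) ∨ (∃ b, a ≠ b ∧ j = c a b ∧ s = sp b) ∨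
    (∃ b, b ≠ a ∧ j = c b a ∧ s = x b a)
  obtain ⟨L, l1, l2, l3⟩ := hall_complete m R (by simp) rfl (by simp; omega) (by omega)
    (by
      rintro a j s s' (⟨h1, h2⟩ | ⟨b, h0, h1, h2⟩ | ⟨b, h0, h1, h2⟩) (⟨g1, g2⟩ | ⟨b', g0, g1, g2⟩ | ⟨b', g0, g1, g2⟩) <;> grind)
    (by
      rintro a j j' s (⟨h1, h2⟩ | ⟨b, h0, h1, h2⟩ | ⟨b, h0, h1, h2⟩) (⟨g1, g2⟩ | ⟨b', g0, g1, g2⟩ | ⟨b', g0, g1, g2⟩) <;> grind [Function.Injective])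
    (by
      rintro a a' j s (⟨h1, h2⟩ | ⟨b, h0, h1, h2⟩ | ⟨b, h0, h1, h2⟩) (⟨g1, g2⟩ | ⟨b', g0, g1, g2⟩ | ⟨b', g0, g1, g2⟩) <;> grind [Function.Injective])
    (fun a => {0} ∪ ((Finset.univ.erase a).image (fun b => c a b) ∪
      (Finset.univ.erase a).image (fun b => c b a)))
    (by
      rintro a j s (⟨h1, h2⟩ | ⟨b, h0, h1, h2⟩ | ⟨b, h0, h1, h2⟩)
      · simp [h1]
      · simp only [Finset.mem_union, Finset.mem_image]
        exact Or.inr (Or.inl ⟨b, by simp [h0.symm], h1.symm⟩)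
      · simp only [Finset.mem_union, Finset.mem_image]
        exact Or.inr (Or.inr ⟨b, by simp [h0], h1.symm⟩))
    (by
      intro a
      have e0 : (Finset.univ.erase a : Finset (Fin m)).card = m - 1 := by simp
      have e1 := Finset.card_image_le (s := Finset.univ.erase a) (f := fun b => c a b)
      have e2 := Finset.card_image_le (s := Finset.univ.erase a) (f := fun b => c b a)
      have e3 := Finset.card_union_le ((Finset.univ.erase a).image (fun b => c a b))
        ((Finset.univ.erase a).image (fun b => c b a))
      have e4 := Finset.card_union_le {0} ((Finset.univ.erase a).image (fun b => c a b) ∪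
        (Finset.univ.erase a).image (fun b => c b a))
      rw [Finset.card_singleton] at e4
      omega)
  exact ⟨L, sp, c, x, l1, l3, hsp, fun i => l2 _ _ _ (Or.inl ⟨rfl, rfl⟩),
    fun a b a' b' h h' hh => (hx a b a' b' h h' hh).2,
    fun a b h => l2 _ _ _ (Or.inr (Or.inl ⟨b, h, rfl, rfl⟩)),
    fun a b h => l2 _ _ _ (Or.inr (Or.inr ⟨a, h, rfl, rfl⟩))⟩

lemma setDist_le_one_iff {V : Type*} (G : SimpleGraph V) (hG : G.Connected) (v : V) (S : Set V)
    (hS : S.Nonempty) : setDist G v S ≤ 1 ↔ ∃ w ∈ S, w = v ∨ G.Adj v w := by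
  unfold setDist
  constructor
  · intro h
    obtain ⟨w, hw, hd⟩ := Nat.sInf_mem (hS.image (G.dist v))
    rw [← hd] at h
    refine ⟨w, hw, ?_⟩
    rcases Nat.le_one_iff_eq_zero_or_eq_one.1 h with h | h
    · exact Or.inl (hG.dist_eq_zero_iff.1 h).symm
    · exact Or.inr (SimpleGraph.dist_eq_one_iff_adj.1 h)
  · rintro ⟨w, hw, h⟩
    have h0 : G.dist v w ∈ G.dist v '' S := ⟨w, hw, rfl⟩
    refine (Nat.sInf_le h0).trans ?_
    rcases h with rfl | h
    · simp
    · exact (SimpleGraph.dist_eq_one_iff_adj.2 h).le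

lemma setDist_eq_zero_iff {V : Type*} (G : SimpleGraph V) (hG : G.Connected) (v : V) (S : Set V)
    (hS : S.Nonempty) : setDist G v S = 0 ↔ v ∈ S := by
  unfold setDist
  constructor
  · intro h
    obtain ⟨w, hw, hd⟩ := Nat.sInf_mem (hS.image (G.dist v))
    rw [h] at hd
    rwa [hG.dist_eq_zero_iff.1 hd]
  · intro h
    have h0 : (0 : ℕ) ∈ G.dist v '' S := ⟨v, h, by simp⟩
    exact Nat.le_zero.1 (Nat.sInf_le h0)

lemma lower_bound (m n k : ℕ) (hm : 2 ≤ m) (hn : 1 ≤ n) 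
    (c : Fin m × Fin n → Fin k)
    (hc : IsLocatingColoring ((⊤ : SimpleGraph (Fin m)) □ (⊤ : SimpleGraph (Fin n))) c) :
    n + 1 ≤ k := by
  by_contra hk
  obtain ⟨hsurj, hprop, hinj⟩ := hc
  have : Nonempty (Fin m) := ⟨⟨0, by omega⟩⟩
  have : Nonempty (Fin n) := ⟨⟨0, by omega⟩⟩
  have hG : ((⊤ : SimpleGraph (Fin m)) □ (⊤ : SimpleGraph (Fin n))).Connected :=
    SimpleGraph.connected_top.boxProd SimpleGraph.connected_top
  have hrow : ∀ i, Function.Injective fun j => c (i, j) := by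
    intro i j j' h
    by_contra hne
    exact hprop (i, j) (i, j') (by simp [SimpleGraph.boxProd_adj, hne]) h
  have hkn : n = k := by
    have := Fintype.card_le_of_injective _ (hrow ⟨0, by omega⟩)
    simp at this
    omega
  have hrs : ∀ i, Function.Surjective fun j => c (i, j) := by
    intro i
    exact ((Fintype.bijective_iff_injective_and_card _).2 ⟨hrow i, by simp [hkn]⟩).2
  let u : Fin m × Fin n := (⟨0, by omega⟩, ⟨0, by omega⟩)
  obtain ⟨j, hj⟩ := hrs ⟨1, by omega⟩ (c u)
  have hcode : ∀ v t, colorCode ((⊤ : SimpleGraph (Fin m)) □ (⊤ : SimpleGraph (Fin n))) c v t =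
      if c v = t then 0 else 1 := by
    rintro ⟨i, j⟩ t
    have hne : (c ⁻¹' {t}).Nonempty := hsurj t
    unfold colorCode
    split_ifs with h
    · exact (setDist_eq_zero_iff _ hG _ _ hne).2 h
    · have h0 := mt (setDist_eq_zero_iff _ hG (i, j) _ hne).1 h
      have h1 := (setDist_le_one_iff _ hG (i, j) _ hne).2 (by
        obtain ⟨j', hj'⟩ := hrs i t
        refine ⟨(i, j'), hj', ?_⟩
        by_cases hjj : j = j'
        · left; rw [hjj]
        · right; simp [SimpleGraph.boxProd_adj, hjj])
      omega
  have := @hinj (⟨1, by omega⟩, j) u (by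
    funext t
    rw [hcode, hcode]
    dsimp only at hj
    rw [hj])
  simp [u] at this

lemma upper_bound (m n : ℕ) (hm : 4 ≤ m) (hn : m * m ≤ n + 3) :
    ∃ c : Fin m × Fin n → Fin (n+1),
      IsLocatingColoring ((⊤ : SimpleGraph (Fin m)) □ (⊤ : SimpleGraph (Fin n))) c := by
  have hmm : 4 * m ≤ m * m := Nat.mul_le_mul_right _ hm
  obtain ⟨L, sp, cc, x, hL, hcol, hsp, hL0, hx, h1, h2⟩ := exists_array m n hm hn
  have : Nonempty (Fin m) := ⟨⟨0, by omega⟩⟩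
  have : Nonempty (Fin n) := ⟨⟨0, by omega⟩⟩
  have hG : ((⊤ : SimpleGraph (Fin m)) □ (⊤ : SimpleGraph (Fin n))).Connected :=
    SimpleGraph.connected_top.boxProd SimpleGraph.connected_top
  let c : Fin m × Fin n → Fin (n+1) := fun p => L p.1 p.2.succ
  have hocc : ∀ i s, s ≠ sp i → ∃ j, c (i, j) = s := by
    intro i s hs
    obtain ⟨j, hj⟩ := (hL i).2 s
    have hj0 : j ≠ 0 := by
      rintro rfl
      exact hs (hj.symm.trans (hL0 i))
    obtain ⟨j', rfl⟩ := Fin.exists_succ_eq.2 hj0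
    exact ⟨j', hj⟩
  have hnocc : ∀ i j, c (i, j) ≠ sp i := by
    intro i j h
    rw [← hL0 i] at h
    exact Fin.succ_ne_zero _ ((hL i).1 h)
  have hsurj : Function.Surjective c := by
    intro s
    by_cases h : s = sp ⟨0, by omega⟩
    · obtain ⟨j, hj⟩ := hocc ⟨1, by omega⟩ s (by
        rw [h]; intro h'; simpa using hsp h')
      exact ⟨_, hj⟩
    · obtain ⟨j, hj⟩ := hocc _ s h
      exact ⟨_, hj⟩
  -- a vertex seeing the missing colour of its own row
  have key : ∀ i i' j j', i ≠ i' →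
      colorCode ((⊤ : SimpleGraph (Fin m)) □ (⊤ : SimpleGraph (Fin n))) c (i, j) =
      colorCode ((⊤ : SimpleGraph (Fin m)) □ (⊤ : SimpleGraph (Fin n))) c (i', j') →
      ∃ a, a ≠ i ∧ c (i, j) = x a i := by
    intro i i' j j' hii h
    have hne : (c ⁻¹' {sp i}).Nonempty := hsurj _
    have h3 := (setDist_le_one_iff _ hG (i', j') _ hne).2 (by
      obtain ⟨b, hb⟩ := hocc i' (sp i) (fun h => hii (hsp h))
      refine ⟨(i', b), hb, ?_⟩
      by_cases hjj : j' = b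
      · left; rw [hjj]
      · right; simp [SimpleGraph.boxProd_adj, hjj])
    have h4 := congrFun h (sp i)
    unfold colorCode at h4
    rw [← h4] at h3
    obtain ⟨⟨a, b⟩, hw, hw'⟩ := (setDist_le_one_iff _ hG (i, j) _ hne).1 h3
    have hw : c (a, b) = sp i := hw
    have hai : a ≠ i := by
      rintro rfl
      exact hnocc _ _ hw
    have hb : b = j := by
      simp only [Prod.mk.injEq, SimpleGraph.boxProd_adj, SimpleGraph.top_adj] at hw'
      grind
    subst hb
    refine ⟨a, hai, ?_⟩
    have : b.succ = cc a i := (hL a).1 (hw.trans (h1 a i hai).symm)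
    show L i b.succ = _
    rw [this, h2 a i hai]
  refine ⟨c, hsurj, ?_, ?_⟩
  · rintro ⟨i, j⟩ ⟨i', j'⟩ hadj h
    simp only [SimpleGraph.boxProd_adj, SimpleGraph.top_adj] at hadj
    rcases hadj with ⟨h3, rfl⟩ | ⟨h3, rfl⟩
    · exact h3 (hcol _ _ _ h)
    · exact h3 (Fin.succ_injective _ ((hL i).1 h))
  · rintro ⟨i, j⟩ ⟨i', j'⟩ h
    have hceq : c (i, j) = c (i', j') := by
      have hne : (c ⁻¹' {c (i, j)}).Nonempty := hsurj _
      have h4 := congrFun h (c (i, j))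
      unfold colorCode at h4
      rw [(setDist_eq_zero_iff _ hG (i, j) _ hne).2 rfl] at h4
      exact ((setDist_eq_zero_iff _ hG (i', j') _ hne).1 h4.symm).symm
    by_cases hii : i = i'
    · subst hii
      exact Prod.ext rfl (Fin.succ_injective _ ((hL i).1 hceq))
    · exfalso
      obtain ⟨a, ha, e⟩ := key i i' j j' hii h
      obtain ⟨a', ha', e'⟩ := key i' i j' j (Ne.symm hii) h.symm
      exact hii (hx a i a' i' ha ha' (by rw [← e, ← e', hceq]))

/-- With `m_0 = max {k : k(k-1) - 1 ≤ n}`, if `n ≥ 3`, `m_0 ≥ 4` and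
`(m_0(m_0-1) - 1) + (m_0 - 2) ≤ n < (m_0+1)m_0 - 1`, then
`χ_L(K_{m_0} □ K_n) = n + 1`. -/
theorem stmt19 (n m₀ : ℕ) (hn : 3 ≤ n)
    (hm₀ : IsGreatest {k : ℕ | k * (k - 1) - 1 ≤ n} m₀)
    (h₁ : 4 ≤ m₀)
    (h₂ : (m₀ * (m₀ - 1) - 1) + (m₀ - 2) ≤ n)
    (h₃ : n < (m₀ + 1) * m₀ - 1) :
    locatingChromaticNumber
      ((⊤ : SimpleGraph (Fin m₀)) □ (⊤ : SimpleGraph (Fin n))) = n + 1 := by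
  have hmm : m₀ * m₀ ≤ n + 3 := by
    obtain ⟨q, rfl⟩ : ∃ q, m₀ = q + 1 := ⟨m₀ - 1, by omega⟩
    simp only [Nat.add_sub_cancel] at h₂
    have : (q + 1) * (q + 1) = (q + 1) * q + (q + 1) := by ring
    omega
  unfold locatingChromaticNumber
  refine IsLeast.csInf_eq ⟨upper_bound m₀ n h₁ hmm, ?_⟩
  rintro k ⟨c, hc⟩
  exact lower_bound m₀ n k (by omega) (by omega) c hc
end
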